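/- arXiv:2605.24519 — 3 statements merged into one kernel-verified Lean document; each statement's English description precedes it below -/
import Mathlib

section
/- Let G_Z ∈ F_2^{(k+k0)×n} be a triorthogonal matrix whose first k rows form a submatrix G_1 ∈ F_2^{k×n} in which every row has odd Hamming weight, and whose last k0 rows form a submatrix H_X ∈ F_2^{k0×n} in which every row has even Hamming weight. Let C_X = (span(rows of H_X))^⊥ = {y ∈ F_2^n : H_X y = 0}, let C_Z be the span of all rows of G_Z, and let 𝒢_1 = span(rows of G_1). Then C_X is the internal direct sum of 𝒢_1 and C_Z^⊥; that is, C_X = 𝒢_1 + C_Z^⊥ and 𝒢_1 ∩ C_Z^⊥ = {0}. -/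
/-- Hamming weight of a vector over `F₂`. -/
def wt {n : ℕ} (y : Fin n → ZMod 2) : ℕ :=
  (Finset.univ.filter fun j => y j ≠ 0).card

/-- A matrix over `F₂` is triorthogonal if the componentwise products of any
two and of any three distinct rows sum to `0` in `F₂`. -/
def Triorthogonal {r n : ℕ} (A : Matrix (Fin r) (Fin n) (ZMod 2)) : Prop :=
  (∀ b c : Fin r, b < c → ∑ j, A b j * A c j = 0) ∧
  (∀ b c d : Fin r, b < c → c < d → ∑ j, A b j * A c j * A d j = 0)

/-- The dual code of an `F₂`-subspace `C ⊆ F₂ⁿ`, with respect to the standard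
inner product `⟨x, y⟩ = ∑ i, x i * y i`. -/
def dualCode {n : ℕ} (C : Submodule (ZMod 2) (Fin n → ZMod 2)) :
    Submodule (ZMod 2) (Fin n → ZMod 2) where
  carrier := {y | ∀ c ∈ C, ∑ i, y i * c i = 0}
  add_mem' := by
    intro a b ha hb c hc
    have h1 := ha c hc
    have h2 := hb c hc
    simp only [Set.mem_setOf_eq, Pi.add_apply, add_mul, Finset.sum_add_distrib, h1, h2,
      add_zero]
  zero_mem' := by
    intro c hc
    simp
  smul_mem' := by
    intro r a ha c hc
    have h1 := ha c hc
    simp only [Set.mem_setOf_eq, Pi.smul_apply, smul_eq_mul, mul_assoc, ← Finset.mul_sum, h1,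
      mul_zero]

/-- Over `F₂`, the inner product of a vector with itself is its weight mod 2. -/
lemma sum_mul_self_eq_wt {n : ℕ} (y : Fin n → ZMod 2) : ∑ j, y j * y j = (wt y : ZMod 2) := by
  rw [wt, Finset.natCast_card_filter]
  refine Finset.sum_congr rfl fun j _ => ?_
  generalize y j = a
  revert a
  decide

/-- Distinct rows of a triorthogonal matrix are orthogonal. -/
lemma Triorthogonal.sum_mul_eq_zero {r n : ℕ} {A : Matrix (Fin r) (Fin n) (ZMod 2)}
    (h : Triorthogonal A) {b c : Fin r} (hbc : b ≠ c) : ∑ j, A b j * A c j = 0 := by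
  rcases lt_or_gt_of_ne hbc with hlt | hgt
  · exact h.1 b c hlt
  · simpa only [mul_comm] using h.1 c b hgt

/-- Membership in the dual of a row span is orthogonality to every row. -/
lemma mem_dualCode_span_range {ι : Type*} {n : ℕ} {v : ι → Fin n → ZMod 2}
    {y : Fin n → ZMod 2} :
    y ∈ dualCode (Submodule.span (ZMod 2) (Set.range v)) ↔ ∀ i, y ⬝ᵥ v i = 0 := by
  refine ⟨fun h i => h _ (Submodule.subset_span ⟨i, rfl⟩), fun h c hc => ?_⟩
  change y ⬝ᵥ c = 0
  induction hc using Submodule.span_induction with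
  | mem x hx =>
    obtain ⟨i, rfl⟩ := hx
    exact h i
  | zero => exact dotProduct_zero y
  | add a b _ _ ha hb => rw [dotProduct_add, ha, hb, add_zero]
  | smul t a _ ha => rw [dotProduct_smul, ha, smul_zero]

/-- If `G_Z` is triorthogonal, its first `k` rows (the matrix `G₁`) have odd
Hamming weight and its last `k₀` rows (the matrix `H_X`) have even Hamming
weight, then `C_X = ker H_X` is the internal direct sum of `𝒢₁`, the span of
the rows of `G₁`, and `C_Z^⊥`, the dual of the span of all rows of `G_Z`. -/
theorem stmt_3 {k k0 n : ℕ} (G : Matrix (Fin (k + k0)) (Fin n) (ZMod 2))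
    (htri : Triorthogonal G)
    (hodd : ∀ i : Fin k, Odd (wt (G (Fin.castAdd k0 i))))
    (heven : ∀ i : Fin k0, Even (wt (G (Fin.natAdd k i)))) :
    LinearMap.ker (Matrix.mulVecLin (Matrix.of fun (i : Fin k0) (j : Fin n) =>
        G (Fin.natAdd k i) j)) =
      Submodule.span (ZMod 2) (Set.range fun i : Fin k => G (Fin.castAdd k0 i)) ⊔
        dualCode (Submodule.span (ZMod 2) (Set.range fun i : Fin (k + k0) => G i)) ∧
    Submodule.span (ZMod 2) (Set.range fun i : Fin k => G (Fin.castAdd k0 i)) ⊓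
        dualCode (Submodule.span (ZMod 2) (Set.range fun i : Fin (k + k0) => G i)) = ⊥ := by
  have hgg (i j : Fin k) :
      G (Fin.castAdd k0 i) ⬝ᵥ G (Fin.castAdd k0 j) = if i = j then 1 else 0 := by
    split_ifs with hij
    · subst hij
      exact (sum_mul_self_eq_wt _).trans (ZMod.natCast_eq_one_iff_odd.2 (hodd i))
    · exact htri.sum_mul_eq_zero fun h => hij (Fin.castAdd_injective k k0 h)
  have hgh (i : Fin k) (j : Fin k0) : G (Fin.castAdd k0 i) ⬝ᵥ G (Fin.natAdd k j) = 0 :=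
    htri.sum_mul_eq_zero fun h => by
      have := congrArg Fin.val h
      simp only [Fin.val_castAdd, Fin.val_natAdd] at this
      omega
  have hcomb (a : Fin k → ZMod 2) (j : Fin k) :
      (∑ i, a i • G (Fin.castAdd k0 i)) ⬝ᵥ G (Fin.castAdd k0 j) = a j := by
    simp [sum_dotProduct, smul_dotProduct, hgg]
  have hker (y : Fin n → ZMod 2) :
      y ∈ LinearMap.ker (Matrix.mulVecLin (Matrix.of fun (i : Fin k0) (j : Fin n) =>
        G (Fin.natAdd k i) j)) ↔ ∀ i : Fin k0, y ⬝ᵥ G (Fin.natAdd k i) = 0 := by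
    simp only [LinearMap.mem_ker, Matrix.mulVecLin_apply, funext_iff, dotProduct_comm y]
    rfl
  refine ⟨le_antisymm (fun y hy => ?_) (sup_le ?_ fun y hy => ?_), ?_⟩
  · rw [hker] at hy
    set p := ∑ i, (y ⬝ᵥ G (Fin.castAdd k0 i)) • G (Fin.castAdd k0 i) with hp
    refine Submodule.mem_sup.2 ⟨p, ?_, y - p, mem_dualCode_span_range.2 fun i => ?_,
      add_sub_cancel p y⟩
    · exact Submodule.sum_mem _ fun i _ =>
        Submodule.smul_mem _ _ (Submodule.subset_span ⟨i, rfl⟩)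
    · induction i using Fin.addCases with
      | left i => rw [sub_dotProduct, hp, hcomb, sub_self]
      | right i =>
        rw [sub_dotProduct, hy, hp]
        simp [sum_dotProduct, smul_dotProduct, hgh]
  · rw [Submodule.span_le]
    rintro _ ⟨i, rfl⟩
    exact (hker _).2 (hgh i)
  · exact (hker y).2 fun i => mem_dualCode_span_range.1 hy _
  · rw [eq_bot_iff]
    rintro x ⟨hx, hxd⟩
    obtain ⟨a, rfl⟩ := (Submodule.mem_span_range_iff_exists_fun _).1 hx
    have ha : a = 0 := funext fun j =>
      (hcomb a j).symm.trans (mem_dualCode_span_range.1 hxd (Fin.castAdd k0 j))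
    simp [ha]
end

section
/- Let G_Z ∈ F_2^{(k+k0)×n} be a triorthogonal matrix whose first k rows form a submatrix G_1 ∈ F_2^{k×n} in which every row has odd Hamming weight, and whose last k0 rows form a submatrix H_X ∈ F_2^{k0×n} in which every row has even Hamming weight. Then dim_{F_2}(span of the rows of G_Z) = k + dim_{F_2}(span of the rows of H_X); equivalently, the corresponding CSS code has dimension equal to the number k of odd-weight rows of G_Z. -/
/-- Over `F₂`, the product of a vector with itself is its weight modulo `2`. -/
lemma dotProduct_self_eq_wt {n : ℕ} (y : Fin n → ZMod 2) : y ⬝ᵥ y = (wt y : ZMod 2) := by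
  have h : ∀ a : ZMod 2, a * a = if a ≠ 0 then 1 else 0 := by decide
  simp_rw [dotProduct, wt, h, Finset.sum_boole]

/-- Distinct rows of a triorthogonal matrix are orthogonal. -/
lemma Triorthogonal.dotProduct_eq_zero {r n : ℕ} {A : Matrix (Fin r) (Fin n) (ZMod 2)}
    (hA : Triorthogonal A) {b c : Fin r} (hbc : b ≠ c) : A b ⬝ᵥ A c = 0 := by
  rcases hbc.lt_or_gt with h | h
  · exact hA.1 b c h
  · rw [dotProduct_comm]
    exact hA.1 c b h

/-- If `G_Z` is triorthogonal, its first `k` rows (the matrix `G₁`) have odd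
Hamming weight and its last `k₀` rows (the matrix `H_X`) have even Hamming
weight, then the dimension of the row space of `G_Z` equals `k` plus the
dimension of the row space of `H_X`; i.e., the corresponding CSS code has
dimension `k`, the number of odd-weight rows of `G_Z`. -/
theorem stmt_4 {k k0 n : ℕ} (G : Matrix (Fin (k + k0)) (Fin n) (ZMod 2))
    (htri : Triorthogonal G)
    (hodd : ∀ i : Fin k, Odd (wt (G (Fin.castAdd k0 i))))
    (heven : ∀ i : Fin k0, Even (wt (G (Fin.natAdd k i)))) :
    Module.finrank (ZMod 2)
        (Submodule.span (ZMod 2) (Set.range fun i : Fin (k + k0) => G i)) =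
      k + Module.finrank (ZMod 2)
        (Submodule.span (ZMod 2) (Set.range fun i : Fin k0 => G (Fin.natAdd k i))) := by
  set A : Fin k → Fin n → ZMod 2 := fun i => G (Fin.castAdd k0 i)
  set H : Fin k0 → Fin n → ZMod 2 := fun i => G (Fin.natAdd k i)
  let f : (Fin n → ZMod 2) →ₗ[ZMod 2] (Fin k → ZMod 2) := (Matrix.of A).mulVecLin
  have hfA : f ∘ A = fun i => Pi.single i (1 : ZMod 2) := by
    ext i j
    change A j ⬝ᵥ A i = _
    obtain rfl | hij := eq_or_ne j i
    · rw [dotProduct_self_eq_wt, ZMod.natCast_eq_one_iff_odd.2 (hodd j), Pi.single_eq_same]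
    · rw [Pi.single_eq_of_ne hij]
      exact htri.dotProduct_eq_zero fun h => hij (Fin.castAdd_injective k k0 h)
  have hli : LinearIndependent (ZMod 2) (f ∘ A) :=
    hfA ▸ Pi.linearIndependent_single_one (Fin k) (ZMod 2)
  have hker : Submodule.span (ZMod 2) (Set.range H) ≤ LinearMap.ker f := by
    rw [Submodule.span_le]
    rintro _ ⟨i, rfl⟩
    ext j
    exact htri.dotProduct_eq_zero fun h => by
      have := congrArg Fin.val h
      simp only [Fin.val_castAdd, Fin.val_natAdd] at this
      omega
  have hdisj := (Submodule.range_ker_disjoint hli).mono_right hker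
  have hrange : Set.range (fun i : Fin (k + k0) => G i) = Set.range A ∪ Set.range H := by
    ext v
    refine ⟨?_, ?_⟩
    · rintro ⟨i, rfl⟩
      induction i using Fin.addCases with
      | left i => exact Or.inl ⟨i, rfl⟩
      | right i => exact Or.inr ⟨i, rfl⟩
    · rintro (⟨i, rfl⟩ | ⟨i, rfl⟩) <;> exact ⟨_, rfl⟩
  have hsum := Submodule.finrank_sup_add_finrank_inf_eq
    (Submodule.span (ZMod 2) (Set.range A)) (Submodule.span (ZMod 2) (Set.range H))
  rw [hdisj.eq_bot, finrank_bot, add_zero, finrank_span_eq_card hli.of_comp,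
    Fintype.card_fin] at hsum
  rw [hrange, Submodule.span_union, hsum]
end

section
/- (Existence criterion for even-weight triorthogonal matrices with prescribed dual distance.) Fix integers n ≥ 1, k0 ≥ 1 and 2 ≤ d⊥ ≤ n, and let V = F_2^{k0} \ {0}. The following are equivalent. (A) There exists H ∈ F_2^{k0×n} such that: (i) rank(H) = k0; (ii) for all 1 ≤ a ≤ b ≤ k0 the number of column indices j with H_{a,j} = H_{b,j} = 1 is even; (iii) for all 1 ≤ a < b < c ≤ k0 the number of j with H_{a,j} = H_{b,j} = H_{c,j} = 1 is even; (iv) every nonzero y ∈ F_2^n with H y = 0 satisfies wt(y) ≥ d⊥. (B) There exist x : V → {0,1,...,n}, nonnegative integers z_P(a,b) for 1 ≤ a ≤ b ≤ k0, nonnegative integers z_T(a,b,c) for 1 ≤ a < b < c ≤ k0, and δ : V × {1,...,n} → {0,1} such that: (L1) Σ_{v ∈ V} x_v = n; (O1) for all a ≤ b, Σ_{v ∈ V} x_v · v_a · v_b = 2 z_P(a,b), where the coordinates v_a ∈ {0,1} are read as integers; (O2) for all a < b < c, Σ_{v ∈ V} x_v · v_a · v_b · v_c = 2 z_T(a,b,c);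 (W1) for each v ∈ V, Σ_{j=1}^{n} δ(v,j) = 1; (W2) for each v ∈ V, Σ_{j=1}^{n} j · δ(v,j) + Σ_{w ∈ V, ⟨v,w⟩=0} x_w = n; (D=) for each 1 ≤ ℓ ≤ d⊥ − 1, Σ_{v ∈ V} Σ_{j=1}^{n} K_ℓ(j;n) · δ(v,j) = −C(n,ℓ); (D≥) for each d⊥ ≤ ℓ ≤ n, Σ_{v ∈ V} Σ_{j=1}^{n} K_ℓ(j;n) · δ(v,j) ≥ −C(n,ℓ). -/
/-- The binary Krawtchouk polynomial value
`K_ℓ(j; n) = ∑_{s=0}^{ℓ} (-1)^s C(j, s) C(n - j, ℓ - s)`, as an integer. -/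
def krawtchouk (ℓ j n : ℕ) : ℤ :=
  ∑ s ∈ Finset.range (ℓ + 1), (-1 : ℤ) ^ s * (j.choose s) * ((n - j).choose (ℓ - s))

open Polynomial in
theorem krawtchouk_eq_coeff (ℓ j n : ℕ) :
    krawtchouk ℓ j n = ((1 - X : ℤ[X]) ^ j * (1 + X) ^ (n - j)).coeff ℓ := by
  have h : (1 - X : ℤ[X]) ^ j = ((1 + X) ^ j).comp (C (-1) * X) := by
    simp [sub_eq_add_neg]
  rw [coeff_mul, Finset.Nat.sum_antidiagonal_eq_sum_range_succ
    (fun s t => ((1 - X : ℤ[X]) ^ j).coeff s * ((1 + X : ℤ[X]) ^ (n - j)).coeff t), krawtchouk]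
  refine Finset.sum_congr rfl fun s _ => ?_
  rw [h, comp_C_mul_X_coeff, coeff_one_add_X_pow, coeff_one_add_X_pow]
  ring

theorem krawtchouk_zero_right (ℓ n : ℕ) : krawtchouk ℓ 0 n = n.choose ℓ := by
  simp [krawtchouk_eq_coeff, Polynomial.coeff_one_add_X_pow]

/-- The nontrivial additive character of `F₂`, with values in `ℤ`. -/
def binarySign : AddChar (ZMod 2) ℤ where
  toFun a := if a = 0 then 1 else -1
  map_zero_eq_one' := by decide
  map_add_eq_mul' := by decide

theorem binarySign_apply (a : ZMod 2) : binarySign a = if a = 0 then 1 else -1 := rfl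

theorem binarySign_dotProduct {k : ℕ} (u w : Fin k → ZMod 2) :
    binarySign (u ⬝ᵥ w) = ∏ i, binarySign (u i * w i) := by
  exact map_prod binarySign.toMonoidHom (fun i => Multiplicative.ofAdd (u i * w i)) Finset.univ

theorem sum_binarySign_dotProduct {k : ℕ} (w : Fin k → ZMod 2) :
    ∑ u : Fin k → ZMod 2, binarySign (u ⬝ᵥ w) = if w = 0 then 2 ^ k else 0 := by
  have h (b : ZMod 2) : ∑ a : ZMod 2, binarySign (a * b) = if b = 0 then 2 else 0 := by
    revert b; decide
  simp only [binarySign_dotProduct]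
  rw [← Fintype.prod_sum (fun i a => binarySign (a * w i))]
  simp only [h]
  split_ifs with hw
  · simp [hw]
  · obtain ⟨i, hi⟩ := Function.ne_iff.mp hw
    exact Finset.prod_eq_zero (Finset.mem_univ i) (if_neg hi)

theorem wt_add_card_zeros {n : ℕ} (y : Fin n → ZMod 2) :
    wt y + (Finset.univ.filter fun j => y j = 0).card = n := by
  rw [wt, add_comm]
  simpa using Finset.card_filter_add_card_filter_not (s := Finset.univ) (fun j => y j = 0)

theorem wt_le {n : ℕ} (y : Fin n → ZMod 2) : wt y ≤ n :=
  Nat.le.intro (wt_add_card_zeros y)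

@[simp]
theorem wt_eq_zero {n : ℕ} {y : Fin n → ZMod 2} : wt y = 0 ↔ y = 0 := by
  simp [wt, Finset.filter_eq_empty_iff, funext_iff]

open Polynomial in
/-- Krawtchouk values are the character sums over a sphere in the Hamming cube. -/
theorem krawtchouk_wt {n : ℕ} (ℓ : ℕ) (c : Fin n → ZMod 2) :
    krawtchouk ℓ (wt c) n =
      ∑ y : Fin n → ZMod 2 with wt y = ℓ, binarySign (c ⬝ᵥ y) := by
  have hfactor (a : ZMod 2) :
      ∑ b : ZMod 2, (C (binarySign (a * b)) * X ^ (if b ≠ 0 then 1 else 0) : ℤ[X]) =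
        if a ≠ 0 then 1 - X else 1 + X := by
    have h01 : a = 0 ∨ a = 1 := by revert a; decide
    have huniv : (Finset.univ : Finset (ZMod 2)) = {0, 1} := rfl
    rcases h01 with rfl | rfl <;> simp [huniv, binarySign_apply, sub_eq_add_neg]
  have hprod : (1 - X : ℤ[X]) ^ wt c * (1 + X) ^ (n - wt c) =
      ∑ y : Fin n → ZMod 2, C (binarySign (c ⬝ᵥ y)) * X ^ wt y := by
    have hcard : n - wt c = (Finset.univ.filter fun j => ¬ c j ≠ 0).card := by
      have := wt_add_card_zeros c
      simp only [not_not]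
      omega
    rw [hcard, wt, ← Finset.prod_const, ← Finset.prod_const, ← Finset.prod_ite]
    simp only [← hfactor]
    rw [Fintype.prod_sum]
    refine Finset.sum_congr rfl fun y _ => ?_
    rw [Finset.prod_mul_distrib, Finset.prod_pow_eq_pow_sum, wt, Finset.card_filter,
      binarySign_dotProduct, map_prod]
  rw [krawtchouk_eq_coeff, hprod, finsetSum_coeff, Finset.sum_filter]
  simp [coeff_X_pow, eq_comm]

/-- MacWilliams identity for the row space of a binary matrix. -/
theorem sum_krawtchouk_vecMul {k n : ℕ} (H : Matrix (Fin k) (Fin n) (ZMod 2)) (ℓ : ℕ) :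
    ∑ u : Fin k → ZMod 2, krawtchouk ℓ (wt (Matrix.vecMul u H)) n =
      2 ^ k * (Finset.univ.filter fun y => wt y = ℓ ∧ H.mulVec y = 0).card := by
  simp only [krawtchouk_wt, ← Matrix.dotProduct_mulVec]
  rw [Finset.sum_comm]
  simp only [sum_binarySign_dotProduct]
  rw [← Finset.sum_filter, Finset.filter_filter, Finset.sum_const, nsmul_eq_mul, mul_comm]

theorem sum_krawtchouk_vecMul_ne_zero {k n : ℕ} (H : Matrix (Fin k) (Fin n) (ZMod 2)) (ℓ : ℕ) :
    ∑ v : {v : Fin k → ZMod 2 // v ≠ 0}, krawtchouk ℓ (wt (Matrix.vecMul v.1 H)) n =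
      2 ^ k * (Finset.univ.filter fun y => wt y = ℓ ∧ H.mulVec y = 0).card - n.choose ℓ := by
  have h := sum_krawtchouk_vecMul H ℓ
  rw [Fintype.sum_eq_add_sum_subtype_ne _ 0, Matrix.zero_vecMul, wt_eq_zero.mpr rfl,
    krawtchouk_zero_right] at h
  linarith

theorem Matrix.rank_eq_card_iff_vecMul_ne_zero {k n : ℕ} {K : Type*} [Field K]
    (H : Matrix (Fin k) (Fin n) K) :
    H.rank = k ↔ ∀ u, u ≠ 0 → Matrix.vecMul u H ≠ 0 := by
  have h : H.rank = k ↔ LinearIndependent K H.row := by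
    rw [linearIndependent_iff_card_eq_finrank_span, Matrix.rank_eq_finrank_span_row,
      Fintype.card_fin, Set.finrank, eq_comm]
  rw [h, ← Matrix.vecMul_injective_iff]
  change Function.Injective (Matrix.vecMulLinear H) ↔ _
  rw [injective_iff_map_eq_zero]
  exact forall_congr' fun u => not_imp_not.symm

theorem sum_fiber_card_mul {ι α : Type*} [Fintype ι] [Fintype α] [DecidableEq α]
    (col : ι → α) (f : α → ℕ) :
    ∑ v, (Finset.univ.filter fun j => col j = v).card * f v = ∑ j, f (col j) := by
  simp only [Finset.card_filter, Finset.sum_mul, ite_mul, one_mul, zero_mul]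
  rw [Finset.sum_comm]
  simp

theorem exists_fiber_card_eq {α : Type*} [Fintype α] [DecidableEq α] {n : ℕ} (x : α → ℕ)
    (hx : ∑ v, x v = n) :
    ∃ col : Fin n → α, ∀ v, (Finset.univ.filter fun j => col j = v).card = x v := by
  have e : Fin n ≃ Σ v, Fin (x v) := Fintype.equivOfCardEq (by simp [hx])
  refine ⟨fun j => (e j).1, fun v => ?_⟩
  rw [← Fintype.card_subtype, ← Fintype.card_fin (x v)]
  exact Fintype.card_congr
    ((e.subtypeEquiv fun _ => Iff.rfl).trans (Equiv.sigmaSubtype v))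

section Columns

variable {k n : ℕ} {H : Matrix (Fin k) (Fin n) (ZMod 2)}
  {col : Fin n → {v : Fin k → ZMod 2 // v ≠ 0}} {x : {v : Fin k → ZMod 2 // v ≠ 0} → ℕ}

theorem val_mul_val_eq_ite (a b : ZMod 2) : a.val * b.val = if a = 1 ∧ b = 1 then 1 else 0 := by
  revert a b; decide

theorem val_mul_val_mul_val_eq_ite (a b c : ZMod 2) :
    a.val * b.val * c.val = if a = 1 ∧ b = 1 ∧ c = 1 then 1 else 0 := by
  revert a b c; decide

theorem sum_mult_mul_pair (hH : ∀ i j, H i j = (col j).1 i)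
    (hx : ∀ v, (Finset.univ.filter fun j => col j = v).card = x v) (a b : Fin k) :
    ∑ v, x v * (v.1 a).val * (v.1 b).val =
      (Finset.univ.filter fun j => H a j = 1 ∧ H b j = 1).card := by
  simp only [mul_assoc, ← hx]
  rw [sum_fiber_card_mul col fun v => (v.1 a).val * (v.1 b).val]
  simp only [val_mul_val_eq_ite, Finset.card_filter, hH]

theorem sum_mult_mul_triple (hH : ∀ i j, H i j = (col j).1 i)
    (hx : ∀ v, (Finset.univ.filter fun j => col j = v).card = x v) (a b c : Fin k) :
    ∑ v, x v * (v.1 a).val * (v.1 b).val * (v.1 c).val =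
      (Finset.univ.filter fun j => H a j = 1 ∧ H b j = 1 ∧ H c j = 1).card := by
  simp only [← hx, mul_assoc]
  rw [sum_fiber_card_mul col fun v => (v.1 a).val * ((v.1 b).val * (v.1 c).val)]
  simp only [← mul_assoc, val_mul_val_mul_val_eq_ite, Finset.card_filter, hH]

theorem wt_vecMul_add_sum_mult (hH : ∀ i j, H i j = (col j).1 i)
    (hx : ∀ v, (Finset.univ.filter fun j => col j = v).card = x v) (u : Fin k → ZMod 2) :
    wt (Matrix.vecMul u H) +
      ∑ w : {v : Fin k → ZMod 2 // v ≠ 0} with ∑ i, u i * w.1 i = 0, x w = n := by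
  have h : ∑ w : {v : Fin k → ZMod 2 // v ≠ 0} with ∑ i, u i * w.1 i = 0, x w =
      (Finset.univ.filter fun j => Matrix.vecMul u H j = 0).card := by
    have := sum_fiber_card_mul col fun w => if ∑ i, u i * w.1 i = 0 then 1 else 0
    simp only [hx, mul_ite, mul_one, mul_zero, ← Finset.sum_filter] at this
    rw [this, Finset.card_filter, Finset.sum_filter]
    simp only [Matrix.vecMul, dotProduct, hH]
  rw [h, wt_add_card_zeros]

end Columns

theorem eq_indicator_of_sum_eq_one {s : Finset ℕ} {f : ℕ → ℕ} (h : ∑ j ∈ s, f j = 1) :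
    ∃ m ∈ s, ∀ j ∈ s, f j = if j = m then 1 else 0 := by
  obtain ⟨m, hm, hm0⟩ : ∃ m ∈ s, f m ≠ 0 := by
    by_contra! h0
    simp [Finset.sum_eq_zero h0] at h
  have hadd := Finset.add_sum_erase s f hm
  have hzero : ∑ j ∈ s.erase m, f j = 0 := by omega
  refine ⟨m, hm, fun j hj => ?_⟩
  split_ifs with hjm
  · subst hjm; omega
  · exact Finset.sum_eq_zero_iff.mp hzero j (Finset.mem_erase.mpr ⟨hjm, hj⟩)

/-- Existence criterion for even-weight triorthogonal matrices with prescribed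
dual distance: existence of a full-rank triorthogonal `H ∈ F₂^{k₀×n}` with even
pairwise (including row weights) and triple overlaps and dual minimum distance
at least `d⊥` is equivalent to feasibility of the integer linear program with
variables `x`, `z_P`, `z_T`, `δ` and constraints (L1), (O1), (O2), (W1), (W2),
(D=), (D≥). Column types are the nonzero vectors `v ∈ V = F₂^{k₀} \ {0}`. -/
theorem stmt_10 (n k0 d : ℕ) (hn : 1 ≤ n) (hk0 : 1 ≤ k0) (hd2 : 2 ≤ d) (hdn : d ≤ n) :
    (∃ H : Matrix (Fin k0) (Fin n) (ZMod 2),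
        H.rank = k0 ∧
        (∀ a b : Fin k0, a ≤ b →
          Even (Finset.univ.filter fun j => H a j = 1 ∧ H b j = 1).card) ∧
        (∀ a b c : Fin k0, a < b → b < c →
          Even (Finset.univ.filter fun j => H a j = 1 ∧ H b j = 1 ∧ H c j = 1).card) ∧
        (∀ y : Fin n → ZMod 2, y ≠ 0 → H.mulVec y = 0 → d ≤ wt y)) ↔
    (∃ (x : {v : Fin k0 → ZMod 2 // v ≠ 0} → ℕ)
        (zP : Fin k0 → Fin k0 → ℕ) (zT : Fin k0 → Fin k0 → Fin k0 → ℕ)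
        (δ : {v : Fin k0 → ZMod 2 // v ≠ 0} → ℕ → ℕ),
        -- x takes values in {0, 1, ..., n} and δ in {0, 1}
        (∀ v, x v ≤ n) ∧
        (∀ v j, δ v j ≤ 1) ∧
        -- (L1)
        (∑ v, x v = n) ∧
        -- (O1): self-orthogonality (row weights and pairwise overlaps are even)
        (∀ a b : Fin k0, a ≤ b →
          ∑ v, x v * ((v : Fin k0 → ZMod 2) a).val * ((v : Fin k0 → ZMod 2) b).val =
            2 * zP a b) ∧
        -- (O2): triorthogonality (triple overlaps are even)
        (∀ a b c : Fin k0, a < b → b < c →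
          ∑ v, x v * ((v : Fin k0 → ZMod 2) a).val * ((v : Fin k0 → ZMod 2) b).val *
              ((v : Fin k0 → ZMod 2) c).val = 2 * zT a b c) ∧
        -- (W1)
        (∀ v, ∑ j ∈ Finset.Icc 1 n, δ v j = 1) ∧
        -- (W2)
        (∀ v : {v : Fin k0 → ZMod 2 // v ≠ 0},
          ∑ j ∈ Finset.Icc 1 n, j * δ v j +
            ∑ w ∈ Finset.univ.filter
                (fun w : {v : Fin k0 → ZMod 2 // v ≠ 0} =>
                  ∑ i, (v : Fin k0 → ZMod 2) i * (w : Fin k0 → ZMod 2) i = 0),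
              x w = n) ∧
        -- (D=)
        (∀ ℓ : ℕ, 1 ≤ ℓ → ℓ ≤ d - 1 →
          ∑ v : {v : Fin k0 → ZMod 2 // v ≠ 0}, ∑ j ∈ Finset.Icc 1 n,
              krawtchouk ℓ j n * (δ v j : ℤ) = -(n.choose ℓ : ℤ)) ∧
        -- (D≥)
        (∀ ℓ : ℕ, d ≤ ℓ → ℓ ≤ n →
          ∑ v : {v : Fin k0 → ZMod 2 // v ≠ 0}, ∑ j ∈ Finset.Icc 1 n,
              krawtchouk ℓ j n * (δ v j : ℤ) ≥ -(n.choose ℓ : ℤ))) := by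
  constructor
  · rintro ⟨H, hrank, hpair, htriple, hdist⟩
    rw [Matrix.rank_eq_card_iff_vecMul_ne_zero] at hrank
    have hcol (j : Fin n) : (fun i => H i j) ≠ 0 := by
      intro h0
      have hy := hdist (Pi.single j 1) (by simp) (by
        rw [Matrix.mulVec_single_one]; exact h0)
      have : wt (Pi.single j 1 : Fin n → ZMod 2) = 1 := by
        simp [wt, Pi.single_apply, Finset.filter_eq']
      omega
    let col : Fin n → {v : Fin k0 → ZMod 2 // v ≠ 0} := fun j => ⟨fun i => H i j, hcol j⟩
    let x : {v : Fin k0 → ZMod 2 // v ≠ 0} → ℕ := fun v =>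
      (Finset.univ.filter fun j => col j = v).card
    have hH (i j) : H i j = (col j).1 i := rfl
    have hx (v) : (Finset.univ.filter fun j => col j = v).card = x v := rfl
    have hmem (v : {v : Fin k0 → ZMod 2 // v ≠ 0}) :
        wt (Matrix.vecMul v.1 H) ∈ Finset.Icc 1 n :=
      Finset.mem_Icc.mpr
        ⟨Nat.one_le_iff_ne_zero.mpr (wt_eq_zero.not.mpr (hrank v.1 v.2)), wt_le _⟩
    have hinner (ℓ : ℕ) :
        ∑ v : {v : Fin k0 → ZMod 2 // v ≠ 0}, ∑ j ∈ Finset.Icc 1 n, krawtchouk ℓ j n *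
            ((if j = wt (Matrix.vecMul v.1 H) then 1 else 0 : ℕ) : ℤ) =
          ∑ v : {v : Fin k0 → ZMod 2 // v ≠ 0}, krawtchouk ℓ (wt (Matrix.vecMul v.1 H)) n := by
      refine Finset.sum_congr rfl fun v _ => ?_
      simp only [Nat.cast_ite, Nat.cast_one, Nat.cast_zero, mul_ite, mul_one, mul_zero]
      rw [Finset.sum_ite_eq', if_pos (hmem v)]
    refine ⟨x, fun a b => (Finset.univ.filter fun j => H a j = 1 ∧ H b j = 1).card / 2,
      fun a b c => (Finset.univ.filter fun j => H a j = 1 ∧ H b j = 1 ∧ H c j = 1).card / 2,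
      fun v j => if j = wt (Matrix.vecMul v.1 H) then 1 else 0,
      fun v => ?_, fun v j => ?_, ?_, fun a b hab => ?_, fun a b c hab hbc => ?_,
      fun v => ?_, fun v => ?_, fun ℓ h1 hℓ => ?_, fun ℓ _ _ => ?_⟩
    · simpa using Finset.card_le_univ (Finset.univ.filter fun j => col j = v)
    · dsimp only
      split_ifs <;> simp
    · simpa [hx] using sum_fiber_card_mul col fun _ => 1
    · rw [sum_mult_mul_pair hH hx, Nat.two_mul_div_two_of_even (hpair a b hab)]
    · rw [sum_mult_mul_triple hH hx, Nat.two_mul_div_two_of_even (htriple a b c hab hbc)]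
    · rw [Finset.sum_ite_eq', if_pos (hmem v)]
    · simp only [mul_ite, mul_one, mul_zero]
      rw [Finset.sum_ite_eq', if_pos (hmem v)]
      exact wt_vecMul_add_sum_mult hH hx v.1
    · have hnone : (Finset.univ.filter fun y => wt y = ℓ ∧ H.mulVec y = 0) = ∅ := by
        refine Finset.filter_eq_empty_iff.mpr fun y _ ⟨hwt, hker⟩ => ?_
        have := hdist y (fun h => by rw [wt_eq_zero.mpr h] at hwt; omega) hker
        omega
      have := sum_krawtchouk_vecMul_ne_zero H ℓ
      rw [hinner, this, hnone]
      simp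
    · have := sum_krawtchouk_vecMul_ne_zero H ℓ
      rw [hinner, this, ge_iff_le, neg_le_sub_iff_le_add]
      exact le_add_of_nonneg_left (mul_nonneg (pow_nonneg zero_le_two _) (Nat.cast_nonneg _))
  · rintro ⟨x, zP, zT, δ, -, -, hsum, hpair, htriple, hδ, hwt, hzero, -⟩
    obtain ⟨col, hx⟩ := exists_fiber_card_eq x hsum
    let H : Matrix (Fin k0) (Fin n) (ZMod 2) := Matrix.of fun i j => (col j).1 i
    have hH (i j) : H i j = (col j).1 i := rfl
    have hδwt (v : {v : Fin k0 → ZMod 2 // v ≠ 0}) :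
        wt (Matrix.vecMul v.1 H) ∈ Finset.Icc 1 n ∧
          ∀ j ∈ Finset.Icc 1 n, δ v j = if j = wt (Matrix.vecMul v.1 H) then 1 else 0 := by
      obtain ⟨m, hm, hδm⟩ := eq_indicator_of_sum_eq_one (hδ v)
      have hsel : ∑ j ∈ Finset.Icc 1 n, j * δ v j = m := by
        rw [Finset.sum_congr rfl fun j hj => by rw [hδm j hj]]
        simp only [mul_ite, mul_one, mul_zero]
        rw [Finset.sum_ite_eq', if_pos hm]
      have hw := hwt v
      have hw' := wt_vecMul_add_sum_mult hH hx v.1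
      have : wt (Matrix.vecMul v.1 H) = m := by omega
      rw [this]
      exact ⟨hm, hδm⟩
    refine ⟨H, ?_, fun a b hab => ?_, fun a b c hab hbc => ?_, fun y hy hker => ?_⟩
    · rw [Matrix.rank_eq_card_iff_vecMul_ne_zero]
      intro u hu h0
      have := (Finset.mem_Icc.mp (hδwt ⟨u, hu⟩).1).1
      rw [wt_eq_zero.mpr h0] at this
      omega
    · rw [← sum_mult_mul_pair hH hx, hpair a b hab]
      exact even_two_mul _
    · rw [← sum_mult_mul_triple hH hx, htriple a b c hab hbc]
      exact even_two_mul _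
    · by_contra! hlt
      have hpos : 1 ≤ wt y := Nat.one_le_iff_ne_zero.mpr (wt_eq_zero.not.mpr hy)
      have hK := hzero (wt y) hpos (by omega)
      have hinner (v : {v : Fin k0 → ZMod 2 // v ≠ 0}) :
          ∑ j ∈ Finset.Icc 1 n, krawtchouk (wt y) j n * (δ v j : ℤ) =
            krawtchouk (wt y) (wt (Matrix.vecMul v.1 H)) n := by
        rw [Finset.sum_congr rfl fun j hj => by rw [(hδwt v).2 j hj]]
        simp only [Nat.cast_ite, Nat.cast_one, Nat.cast_zero, mul_ite, mul_one, mul_zero]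
        rw [Finset.sum_ite_eq', if_pos (hδwt v).1]
      rw [Finset.sum_congr rfl fun v _ => hinner v, sum_krawtchouk_vecMul_ne_zero] at hK
      have hcard : 0 < (Finset.univ.filter fun z => wt z = wt y ∧ H.mulVec z = 0).card :=
        Finset.card_pos.mpr ⟨y, by simp [hker]⟩
      have : (0 : ℤ) <
          2 ^ k0 * (Finset.univ.filter fun z => wt z = wt y ∧ H.mulVec z = 0).card :=
        mul_pos (pow_pos two_pos _) (Nat.cast_pos.mpr hcard)
      linarith
end
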